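/- Fix real numbers y₁, y₂, s and t with t > s. Let Q₁ and Q₂ be defined as in the context. Then marginalizing Q₂ over its second spatial coordinate recovers Q₁: for every x₁ ∈ ℝ, ∫_ℝ Q₂(x₁, x₂, t | y₁, y₂, s) dx₂ = Q₁(x₁, t | y₁, s). (This is the concrete instance, for the paper's illustrative example, of the general marginalization lemma relating the transition density of the (k+1)-component system to that of the k-component system.) -/

import Mathlib

open Real MeasureTheory

/-- The Gaussian heat kernel `Q₁(x, t | y, s) = (2π(t−s))^{−1/2} exp(−(x−y)²/(2(t−s)))`. -/
noncomputable def Q1 (x t y s : ℝ) : ℝ :=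
  (Real.sqrt (2 * Real.pi * (t - s)))⁻¹ * Real.exp (-(x - y) ^ 2 / (2 * (t - s)))

/-- The explicit Gaussian transition density `Q₂(x₁, x₂, t | y₁, y₂, s)` of the SDE system
`dX₁ = dB₁`, `dX₂ = X₁ dt + dB₂`, with `Δ = t − s`. -/
noncomputable def Q2 (x₁ x₂ t y₁ y₂ s : ℝ) : ℝ :=
  (2 * Real.pi * (t - s) * Real.sqrt (((t - s) ^ 2 + 12) / 12))⁻¹ *
    Real.exp (-((2 * (t - s) ^ 2 + 6) / ((t - s) ^ 2 + 12)) *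
      ((x₁ - y₁) ^ 2 / (t - s)
        - 3 * (x₁ - y₁) * (x₂ - y₂ - y₁ * (t - s)) / ((t - s) ^ 2 + 3)
        + 3 * (x₂ - y₂ - y₁ * (t - s)) ^ 2 / ((t - s) ^ 3 + 3 * (t - s))))

/-- Completing the square in `x₂`: `Q₂` is a Gaussian in `x₂` with mean
`y₂ + y₁ Δ + (x₁ − y₁) Δ / 2`, times the exponential factor of `Q₁`. -/
theorem Q2_eq_mul_exp_sq {s t : ℝ} (ht : s < t) (x₁ x₂ y₁ y₂ : ℝ) :
    Q2 x₁ x₂ t y₁ y₂ s =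
      ((2 * Real.pi * (t - s) * Real.sqrt (((t - s) ^ 2 + 12) / 12))⁻¹ *
        Real.exp (-(x₁ - y₁) ^ 2 / (2 * (t - s)))) *
      Real.exp (-(6 / ((t - s) * ((t - s) ^ 2 + 12))) *
        (x₂ - (y₂ + y₁ * (t - s) + (x₁ - y₁) * (t - s) / 2)) ^ 2) := by
  have hd : 0 < t - s := sub_pos.mpr ht
  rw [Q2, mul_assoc _ (Real.exp _), ← Real.exp_add]
  generalize t - s = d at *
  have hd3 : d ^ 3 + 3 * d = d * (d ^ 2 + 3) := by ring
  have h3 : d ^ 2 + 3 ≠ 0 := by positivity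
  have h12 : d ^ 2 + 12 ≠ 0 := by positivity
  congr 2
  rw [hd3]
  field_simp
  ring

/-- The normalizing constants of `Q₂` and `Q₁` differ by the Gaussian integral over `x₂`. -/
theorem inv_mul_sqrt_pi_div_eq {d : ℝ} (hd : 0 < d) :
    (2 * Real.pi * d * Real.sqrt ((d ^ 2 + 12) / 12))⁻¹ *
      Real.sqrt (Real.pi / (6 / (d * (d ^ 2 + 12)))) = (Real.sqrt (2 * Real.pi * d))⁻¹ := by
  have hp : 0 < 2 * Real.pi * d := by positivity
  have hq : Real.sqrt ((d ^ 2 + 12) / 12) ≠ 0 := by positivity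
  have hr : Real.sqrt (2 * Real.pi * d) ≠ 0 := by positivity
  have hsplit : Real.pi / (6 / (d * (d ^ 2 + 12))) =
      2 * Real.pi * d * ((d ^ 2 + 12) / 12) := by
    field_simp
    ring
  rw [hsplit, Real.sqrt_mul hp.le, mul_inv, mul_mul_mul_comm, inv_mul_cancel₀ hq, mul_one]
  nth_rewrite 1 [← Real.mul_self_sqrt hp.le]
  rw [mul_inv, mul_assoc, inv_mul_cancel₀ hr, mul_one]

/-- Marginalizing `Q₂` over its second spatial coordinate recovers `Q₁`:
`∫ Q₂(x₁, x₂, t | y₁, y₂, s) dx₂ = Q₁(x₁, t | y₁, s)`. -/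
theorem Q2_marginal_eq_Q1 (y₁ y₂ s t : ℝ) (ht : s < t) (x₁ : ℝ) :
    ∫ x₂ : ℝ, Q2 x₁ x₂ t y₁ y₂ s = Q1 x₁ t y₁ s := by
  simp_rw [Q2_eq_mul_exp_sq ht]
  rw [integral_const_mul,
    integral_sub_right_eq_self
      (fun x : ℝ => Real.exp (-(6 / ((t - s) * ((t - s) ^ 2 + 12))) * x ^ 2)),
    integral_gaussian, mul_right_comm, inv_mul_sqrt_pi_div_eq (sub_pos.mpr ht), Q1]
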